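/- Let p0, p1, p2, p3 : ℝ → ℝ³ be continuously differentiable curves such that for every t in an open interval J the four points are affinely independent, and let ℓ_{ij}(t) and Φ_{ij}(t) be the edge lengths and interior dihedral angles of the corresponding tetrahedron. Define the total discrete mean curvature H(t) = (1/2) ∑_{i<j} ℓ_{ij}(t) Φ_{ij}(t) (sum over the six edges). Then H is differentiable on J with H'(t) = (1/2) ∑_{i<j} Φ_{ij}(t) ℓ_{ij}'(t). In particular, if all edge lengths are constant in t except one edge e0 for which ℓ_{e0}(t) = 2t, then H'(t) = Φ_{e0}(t): the derivative of the total discrete mean curvature with respect to the half-length of the varying edge is the dihedral angle at that edge. -/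

import Mathlib

open scoped RealInnerProductSpace

/-- The component of `v` orthogonal to `w`. -/
noncomputable def perpComp (w v : EuclideanSpace ℝ (Fin 3)) : EuclideanSpace ℝ (Fin 3) :=
  v - (⟪v, w⟫ / ‖w‖ ^ 2) • w

/-- The interior dihedral angle of the tetrahedron with vertices `q 0, q 1, q 2, q 3`
along the edge `{i, j}`, where `{k, l}` is the complementary pair of indices. -/
noncomputable def dihedral (q : Fin 4 → EuclideanSpace ℝ (Fin 3)) (i j k l : Fin 4) : ℝ :=
  InnerProductGeometry.angle
    (perpComp (q j - q i) (q k - q i))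
    (perpComp (q j - q i) (q l - q i))

/-- The six edges of a tetrahedron, each listed together with the complementary pair
of vertex indices: `(i, j, k, l)` with edge `{i, j}` and `{k, l} = {0,1,2,3} \ {i,j}`. -/
def tetraEdges : List (Fin 4 × Fin 4 × Fin 4 × Fin 4) :=
  [(0, 1, 2, 3), (0, 2, 1, 3), (0, 3, 1, 2), (1, 2, 0, 3), (1, 3, 0, 2), (2, 3, 0, 1)]

/-- The length of the edge `e` of the moving tetrahedron at time `t`. -/
noncomputable def edgeLen (p : Fin 4 → ℝ → EuclideanSpace ℝ (Fin 3))
    (e : Fin 4 × Fin 4 × Fin 4 × Fin 4) (t : ℝ) : ℝ :=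
  ‖p e.1 t - p e.2.1 t‖

/-- The interior dihedral angle along the edge `e` of the moving tetrahedron at time `t`. -/
noncomputable def edgeAngle (p : Fin 4 → ℝ → EuclideanSpace ℝ (Fin 3))
    (e : Fin 4 × Fin 4 × Fin 4 × Fin 4) (t : ℝ) : ℝ :=
  dihedral (fun m => p m t) e.1 e.2.1 e.2.2.1 e.2.2.2

/-- The total discrete mean curvature `H(t) = (1/2) ∑_{i<j} ℓ_{ij}(t) Φ_{ij}(t)` of the
moving tetrahedron. -/
noncomputable def totalMeanCurvature (p : Fin 4 → ℝ → EuclideanSpace ℝ (Fin 3))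
    (t : ℝ) : ℝ :=
  (1 / 2) * (tetraEdges.map (fun e => edgeLen p e t * edgeAngle p e t)).sum

lemma inner_eq_coord (x y : EuclideanSpace ℝ (Fin 3)) :
    ⟪x, y⟫ = x 0 * y 0 + x 1 * y 1 + x 2 * y 2 := by
  simp [PiLp.inner_apply, Fin.sum_univ_three]
  ring

/-- The determinant of three vectors of `ℝ³`. -/
def tripleProduct (x y z : EuclideanSpace ℝ (Fin 3)) : ℝ :=
  x 0 * (y 1 * z 2 - y 2 * z 1) - x 1 * (y 0 * z 2 - y 2 * z 0)
    + x 2 * (y 0 * z 1 - y 1 * z 0)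

/-- The Gram determinant of two vectors. -/
noncomputable def gramDet (w u : EuclideanSpace ℝ (Fin 3)) : ℝ :=
  ⟪w, w⟫ * ⟪u, u⟫ - ⟪w, u⟫ ^ 2

/-- The inner product of the cross products `w × u` and `w × v`. -/
noncomputable def mixedGram (w u v : EuclideanSpace ℝ (Fin 3)) : ℝ :=
  ⟪w, w⟫ * ⟪u, v⟫ - ⟪w, u⟫ * ⟪w, v⟫

lemma gramDet_mul_gramDet_sub (w u v : EuclideanSpace ℝ (Fin 3)) :
    gramDet w u * gramDet w v - mixedGram w u v ^ 2
      = ‖w‖ ^ 2 * tripleProduct w u v ^ 2 := by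
  rw [← real_inner_self_eq_norm_sq]
  simp only [gramDet, mixedGram, inner_eq_coord, tripleProduct]
  ring

lemma tripleProduct_swap (w u v : EuclideanSpace ℝ (Fin 3)) :
    tripleProduct w v u = -tripleProduct w u v := by
  simp only [tripleProduct]
  ring

lemma gramDet_pos {w u v : EuclideanSpace ℝ (Fin 3)} (h : tripleProduct w u v ≠ 0) :
    0 < gramDet w u := by
  have hv : 0 ≤ ⟪v, v⟫ := real_inner_self_nonneg
  have key : gramDet w u * ⟪v, v⟫ - tripleProduct w u v ^ 2 =
      (⟪u, v⟫ * w 0 - ⟪w, v⟫ * u 0) ^ 2 + (⟪u, v⟫ * w 1 - ⟪w, v⟫ * u 1) ^ 2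
        + (⟪u, v⟫ * w 2 - ⟪w, v⟫ * u 2) ^ 2 := by
    simp only [gramDet, inner_eq_coord, tripleProduct]
    ring
  have : 0 < tripleProduct w u v ^ 2 := by positivity
  have hpos : 0 < gramDet w u * ⟪v, v⟫ := by
    nlinarith [sq_nonneg (⟪u, v⟫ * w 0 - ⟪w, v⟫ * u 0),
      sq_nonneg (⟪u, v⟫ * w 1 - ⟪w, v⟫ * u 1), sq_nonneg (⟪u, v⟫ * w 2 - ⟪w, v⟫ * u 2)]
  exact pos_of_mul_pos_left hpos hv

lemma ne_zero_of_tripleProduct {w u v : EuclideanSpace ℝ (Fin 3)}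
    (h : tripleProduct w u v ≠ 0) : w ≠ 0 := by
  rintro rfl
  simp [tripleProduct] at h

lemma inner_perpComp {w : EuclideanSpace ℝ (Fin 3)} (hw : w ≠ 0)
    (u v : EuclideanSpace ℝ (Fin 3)) :
    ⟪perpComp w u, perpComp w v⟫ = mixedGram w u v / ‖w‖ ^ 2 := by
  have hw' : ‖w‖ ≠ 0 := norm_ne_zero_iff.mpr hw
  simp only [perpComp, mixedGram, inner_sub_left, inner_sub_right, real_inner_smul_left,
    real_inner_smul_right, real_inner_self_eq_norm_sq, real_inner_comm w]
  field_simp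
  ring

lemma mixedGram_self (w u : EuclideanSpace ℝ (Fin 3)) : mixedGram w u u = gramDet w u := by
  simp only [mixedGram, gramDet]
  ring

lemma norm_perpComp {w : EuclideanSpace ℝ (Fin 3)} (hw : w ≠ 0)
    (u : EuclideanSpace ℝ (Fin 3)) :
    ‖perpComp w u‖ = √(gramDet w u) / ‖w‖ := by
  rw [norm_eq_sqrt_real_inner, inner_perpComp hw, mixedGram_self,
    Real.sqrt_div' _ (sq_nonneg _), Real.sqrt_sq (norm_nonneg w)]

lemma angle_perpComp {w u v : EuclideanSpace ℝ (Fin 3)} (h : tripleProduct w u v ≠ 0) :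
    InnerProductGeometry.angle (perpComp w u) (perpComp w v)
      = Real.arccos (mixedGram w u v / √(gramDet w u * gramDet w v)) := by
  have hw := ne_zero_of_tripleProduct h
  have hw' : ‖w‖ ≠ 0 := norm_ne_zero_iff.mpr hw
  have hu := gramDet_pos h
  rw [InnerProductGeometry.angle, inner_perpComp hw, norm_perpComp hw, norm_perpComp hw,
    Real.sqrt_mul hu.le]
  congr 1
  field_simp

lemma HasDerivAt.arccos_div_sqrt {P Q R : ℝ → ℝ} {P' Q' R' t : ℝ}
    (hP : HasDerivAt P P' t) (hQ : HasDerivAt Q Q' t) (hR : HasDerivAt R R' t)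
    (hQ0 : 0 < Q t) (hR0 : 0 < R t) (h : P t ^ 2 < Q t * R t) :
    HasDerivAt (fun s => Real.arccos (P s / √(Q s * R s)))
      (-(P' - P t / 2 * (Q' / Q t + R' / R t)) / √(Q t * R t - P t ^ 2)) t := by
  have hQR : 0 < Q t * R t := mul_pos hQ0 hR0
  have hS : 0 < √(Q t * R t) := Real.sqrt_pos.mpr hQR
  have hSS : √(Q t * R t) ^ 2 = Q t * R t := Real.sq_sqrt hQR.le
  have hlt : (P t / √(Q t * R t)) ^ 2 < 1 := by
    rw [div_pow, hSS, div_lt_one hQR]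
    exact h
  have habs := abs_lt.mp ((sq_lt_one_iff_abs_lt_one _).mp hlt)
  have hd := (Real.hasDerivAt_arccos habs.1.ne' habs.2.ne).comp t
    (hP.fun_div ((hQ.fun_mul hR).sqrt hQR.ne') hS.ne')
  have hroot : √(1 - (P t / √(Q t * R t)) ^ 2)
      = √(Q t * R t - P t ^ 2) / √(Q t * R t) := by
    rw [← Real.sqrt_div' _ hQR.le, div_pow, hSS, sub_div, div_self hQR.ne']
  have hT : 0 < √(Q t * R t - P t ^ 2) := Real.sqrt_pos.mpr (by linarith)
  refine hd.congr_deriv ?_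
  rw [hroot, hSS]
  field_simp
  rw [hSS]

/-- The contribution of a moving triangle `x y z` with vertex velocities `x' y' z'` to the
variation of the dihedral angle along `x y`. -/
noncomputable def faceTerm (x y z x' y' z' : EuclideanSpace ℝ (Fin 3)) : ℝ :=
  (⟪y - x, y - x⟫ * tripleProduct (y - x) (z - x) (z' - x')
    - ⟪y - x, z - x⟫ * tripleProduct (y - x) (z - x) (y' - x')) / gramDet (y - x) (z - x)

lemma faceTerm_swap (x y z x' y' z' : EuclideanSpace ℝ (Fin 3)) :
    faceTerm y x z y' x' z' = -faceTerm x y z x' y' z' := by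
  have hg : gramDet (x - y) (z - y) = gramDet (y - x) (z - x) := by
    simp only [gramDet, inner_eq_coord, PiLp.sub_apply]
    ring
  rw [faceTerm, faceTerm, hg, ← neg_div]
  congr 1
  simp only [tripleProduct, inner_eq_coord, PiLp.sub_apply]
  ring

lemma faceTerm_cyclic_sum (x y z x' y' z' : EuclideanSpace ℝ (Fin 3)) :
    faceTerm x y z x' y' z' + faceTerm y z x y' z' x' + faceTerm z x y z' x' y' = 0 := by
  have h₁ : gramDet (z - y) (x - y) = gramDet (y - x) (z - x) := by
    simp only [gramDet, inner_eq_coord, PiLp.sub_apply]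
    ring
  have h₂ : gramDet (x - z) (y - z) = gramDet (y - x) (z - x) := by
    simp only [gramDet, inner_eq_coord, PiLp.sub_apply]
    ring
  rw [faceTerm, faceTerm, faceTerm, h₁, h₂, ← add_div, ← add_div]
  refine div_eq_zero_iff.mpr (Or.inl ?_)
  simp only [tripleProduct, inner_eq_coord, PiLp.sub_apply]
  ring

lemma mixedGram_variation (w u v w' u' : EuclideanSpace ℝ (Fin 3)) :
    (⟪w', w⟫ * ⟪u, v⟫ - ⟪w', v⟫ * ⟪u, w⟫ + ⟪w, w⟫ * ⟪u', v⟫ - ⟪w, v⟫ * ⟪w, u'⟫) * gramDet w u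
      - mixedGram w u v * (⟪w', w⟫ * ⟪u, u⟫ + ⟪w, w⟫ * ⟪u', u⟫ - ⟪w, u⟫ * (⟪w', u⟫ + ⟪w, u'⟫))
      = tripleProduct w u v *
        (⟪w, w⟫ * tripleProduct w u u' - ⟪w, u⟫ * tripleProduct w u w') := by
  simp only [tripleProduct, mixedGram, gramDet, inner_eq_coord]
  ring

lemma HasDerivAt.gramDet {w u : ℝ → EuclideanSpace ℝ (Fin 3)}
    {w' u' : EuclideanSpace ℝ (Fin 3)} {t : ℝ}
    (hw : HasDerivAt w w' t) (hu : HasDerivAt u u' t) :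
    HasDerivAt (fun s => gramDet (w s) (u s))
      (2 * (⟪w', w t⟫ * ⟪u t, u t⟫ + ⟪w t, w t⟫ * ⟪u', u t⟫
        - ⟪w t, u t⟫ * (⟪w', u t⟫ + ⟪w t, u'⟫))) t := by
  refine (((hw.inner ℝ hw).fun_mul (hu.inner ℝ hu)).fun_sub
    ((hw.inner ℝ hu).fun_pow 2)).congr_deriv ?_
  simp only [inner_eq_coord]
  ring

lemma HasDerivAt.mixedGram {w u v : ℝ → EuclideanSpace ℝ (Fin 3)}
    {w' u' v' : EuclideanSpace ℝ (Fin 3)} {t : ℝ}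
    (hw : HasDerivAt w w' t) (hu : HasDerivAt u u' t) (hv : HasDerivAt v v' t) :
    HasDerivAt (fun s => mixedGram (w s) (u s) (v s))
      ((⟪w', w t⟫ * ⟪u t, v t⟫ - ⟪w', v t⟫ * ⟪u t, w t⟫
          + ⟪w t, w t⟫ * ⟪u', v t⟫ - ⟪w t, v t⟫ * ⟪w t, u'⟫)
        + (⟪w', w t⟫ * ⟪v t, u t⟫ - ⟪w', u t⟫ * ⟪v t, w t⟫
          + ⟪w t, w t⟫ * ⟪v', u t⟫ - ⟪w t, u t⟫ * ⟪w t, v'⟫)) t := by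
  refine (((hw.inner ℝ hw).fun_mul (hu.inner ℝ hv)).fun_sub
    ((hw.inner ℝ hu).fun_mul (hw.inner ℝ hv))).congr_deriv ?_
  simp only [inner_eq_coord]
  ring

lemma mixedGram_comm (w u v : EuclideanSpace ℝ (Fin 3)) :
    mixedGram w v u = mixedGram w u v := by
  simp only [mixedGram, inner_eq_coord]
  ring

lemma ContinuousAt.tripleProduct {w u v : ℝ → EuclideanSpace ℝ (Fin 3)} {t : ℝ}
    (hw : ContinuousAt w t) (hu : ContinuousAt u t) (hv : ContinuousAt v t) :
    ContinuousAt (fun s => _root_.tripleProduct (w s) (u s) (v s)) t := by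
  have hc : ∀ {f : ℝ → EuclideanSpace ℝ (Fin 3)}, ContinuousAt f t → ∀ i,
      ContinuousAt (fun s => f s i) t := fun hf i =>
    (EuclideanSpace.proj (𝕜 := ℝ) i).continuous.continuousAt.comp hf
  have := hc hw
  have := hc hu
  have := hc hv
  unfold _root_.tripleProduct
  fun_prop (disch := assumption)

lemma hasDerivAt_angle_perpComp {x y z q : ℝ → EuclideanSpace ℝ (Fin 3)}
    {x' y' z' q' : EuclideanSpace ℝ (Fin 3)} {t : ℝ}
    (hx : HasDerivAt x x' t) (hy : HasDerivAt y y' t) (hz : HasDerivAt z z' t)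
    (hq : HasDerivAt q q' t) (h : tripleProduct (y t - x t) (z t - x t) (q t - x t) ≠ 0) :
    HasDerivAt (fun s => InnerProductGeometry.angle
        (perpComp (y s - x s) (z s - x s)) (perpComp (y s - x s) (q s - x s)))
      (-(tripleProduct (y t - x t) (z t - x t) (q t - x t)
          / |tripleProduct (y t - x t) (z t - x t) (q t - x t)|)
        * (faceTerm (x t) (y t) (z t) x' y' z' - faceTerm (x t) (y t) (q t) x' y' q')
        / ‖x t - y t‖) t := by
  have hw := hy.fun_sub hx
  have hu := hz.fun_sub hx
  have hv := hq.fun_sub hx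
  have hnhds := (hw.continuousAt.tripleProduct hu.continuousAt
    hv.continuousAt).eventually_ne h
  have hQ := gramDet_pos h
  have hR : 0 < gramDet (y t - x t) (q t - x t) :=
    gramDet_pos (v := z t - x t) (by rw [tripleProduct_swap]; exact neg_ne_zero.mpr h)
  have hw0 : 0 < ‖y t - x t‖ := norm_pos_iff.mpr (ne_zero_of_tripleProduct h)
  have hgram := gramDet_mul_gramDet_sub (y t - x t) (z t - x t) (q t - x t)
  have hD : 0 < |tripleProduct (y t - x t) (z t - x t) (q t - x t)| := abs_pos.mpr h
  have hlt : mixedGram (y t - x t) (z t - x t) (q t - x t) ^ 2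
      < gramDet (y t - x t) (z t - x t) * gramDet (y t - x t) (q t - x t) := by
    have : 0 < ‖y t - x t‖ ^ 2 * tripleProduct (y t - x t) (z t - x t) (q t - x t) ^ 2 := by
      positivity
    linarith
  have hd := (hw.mixedGram hu hv).arccos_div_sqrt (hw.gramDet hu) (hw.gramDet hv) hQ hR hlt
  refine (hd.congr_of_eventuallyEq (hnhds.mono fun s hs => angle_perpComp hs)).congr_deriv ?_
  have e₁ := mixedGram_variation (y t - x t) (z t - x t) (q t - x t) (y' - x') (z' - x')
  have e₂ := mixedGram_variation (y t - x t) (q t - x t) (z t - x t) (y' - x') (q' - x')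
  rw [hgram, Real.sqrt_mul (sq_nonneg _), Real.sqrt_sq hw0.le, Real.sqrt_sq_eq_abs,
    norm_sub_rev (x t), faceTerm, faceTerm]
  rw [tripleProduct_swap, mixedGram_comm] at e₂
  generalize gramDet (y t - x t) (z t - x t) = Q at *
  generalize gramDet (y t - x t) (q t - x t) = R at *
  generalize |tripleProduct (y t - x t) (z t - x t) (q t - x t)| = A at *
  generalize ‖y t - x t‖ = L at *
  field_simp
  linear_combination -R * e₁ - Q * e₂

lemma tripleProduct_ne_zero {q : Fin 4 → EuclideanSpace ℝ (Fin 3)}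
    (h : AffineIndependent ℝ q) :
    tripleProduct (q 1 - q 0) (q 2 - q 0) (q 3 - q 0) ≠ 0 := by
  intro h0
  let M : Matrix (Fin 3) (Fin 3) ℝ := fun i j => q i.succ j - q 0 j
  have hM : M.det = 0 := by
    rw [← h0, Matrix.det_fin_three]
    simp [M, tripleProduct]
    ring
  obtain ⟨c, hc, hcM⟩ := Matrix.exists_vecMul_eq_zero_iff.mpr hM
  have hw := affineIndependent_iff.mp h Finset.univ
    (Fin.cons (-∑ i, c i) c : Fin 4 → ℝ) (by simp [Fin.sum_univ_succ]) (by
      ext j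
      have := congrFun hcM j
      simp [Matrix.vecMul, dotProduct, Fin.sum_univ_succ, M] at this ⊢
      linarith)
  exact hc (funext fun i => by simpa using hw i.succ (Finset.mem_univ _))

/-- **Schläfli formula**: the edge angles of a moving tetrahedron are differentiable, and their
derivatives weighted by the edge lengths sum to zero. -/
lemma exists_hasDerivAt_edgeAngle {p : Fin 4 → ℝ → EuclideanSpace ℝ (Fin 3)} {t : ℝ}
    (hp : ∀ i, DifferentiableAt ℝ (p i) t) (h : AffineIndependent ℝ (fun i => p i t)) :
    ∃ φ : Fin 4 × Fin 4 × Fin 4 × Fin 4 → ℝ,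
      (∀ e ∈ tetraEdges, HasDerivAt (edgeAngle p e) (φ e) t) ∧
      (tetraEdges.map (fun e => edgeLen p e t * φ e)).sum = 0 := by
  let D := fun i j k l : Fin 4 => tripleProduct (p j t - p i t) (p k t - p i t) (p l t - p i t)
  let F := fun i j k : Fin 4 =>
    faceTerm (p i t) (p j t) (p k t) (deriv (p i) t) (deriv (p j) t) (deriv (p k) t)
  have h0 : D 0 1 2 3 ≠ 0 := tripleProduct_ne_zero h
  have d₁ : D 0 2 1 3 = -D 0 1 2 3 := by simp only [D, tripleProduct, PiLp.sub_apply]; ring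
  have d₂ : D 0 3 1 2 = D 0 1 2 3 := by simp only [D, tripleProduct, PiLp.sub_apply]; ring
  have d₃ : D 1 2 0 3 = D 0 1 2 3 := by simp only [D, tripleProduct, PiLp.sub_apply]; ring
  have d₄ : D 1 3 0 2 = -D 0 1 2 3 := by simp only [D, tripleProduct, PiLp.sub_apply]; ring
  have d₅ : D 2 3 0 1 = D 0 1 2 3 := by simp only [D, tripleProduct, PiLp.sub_apply]; ring
  have hD : ∀ e ∈ tetraEdges, D e.1 e.2.1 e.2.2.1 e.2.2.2 ≠ 0 := by
    simp [tetraEdges, d₁, d₂, d₃, d₄, d₅, h0]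
  have hlen : ∀ e ∈ tetraEdges, edgeLen p e t ≠ 0 := fun e he => by
    rw [edgeLen, norm_sub_rev]
    exact norm_ne_zero_iff.mpr (ne_zero_of_tripleProduct (hD e he))
  refine ⟨fun e => -(D e.1 e.2.1 e.2.2.1 e.2.2.2 / |D e.1 e.2.1 e.2.2.1 e.2.2.2|)
      * (F e.1 e.2.1 e.2.2.1 - F e.1 e.2.1 e.2.2.2) / edgeLen p e t, fun e he =>
    hasDerivAt_angle_perpComp (hp _).hasDerivAt (hp _).hasDerivAt (hp _).hasDerivAt
      (hp _).hasDerivAt (hD e he), ?_⟩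
  rw [List.map_congr_left fun e he => mul_div_cancel₀ _ (hlen e he)]
  have swap : ∀ i j k, F j i k = -F i j k := fun i j k => faceTerm_swap _ _ _ _ _ _
  have cyc : ∀ i j k, F i j k + F j k i + F k i j = 0 := fun i j k =>
    faceTerm_cyclic_sum _ _ _ _ _ _
  simp only [tetraEdges, List.map_cons, List.map_nil, List.sum_cons, List.sum_nil,
    d₁, d₂, d₃, d₄, d₅, abs_neg]
  linear_combination (D 0 1 2 3 / |D 0 1 2 3|) *
    (-cyc 0 1 2 + cyc 0 1 3 - cyc 0 2 3 + cyc 1 2 3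
      + swap 0 2 1 - swap 0 3 1 + swap 0 3 2 - swap 1 3 2)

/-- **Derivative of the total discrete mean curvature of a tetrahedron.**
If the vertices move along `C¹` curves and stay affinely independent on an open interval
`J`, then `H(t) = (1/2) ∑ ℓ_{ij} Φ_{ij}` is differentiable with
`H'(t) = (1/2) ∑ Φ_{ij}(t) ℓ_{ij}'(t)`.  In particular, if all edge lengths are constant
in `t` except one edge `e0` with `ℓ_{e0}(t) = 2t`, then `H'(t) = Φ_{e0}(t)`. -/
theorem totalMeanCurvature_deriv
    (p : Fin 4 → ℝ → EuclideanSpace ℝ (Fin 3))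
    (hp : ∀ i, ContDiff ℝ 1 (p i))
    (a b : ℝ) (J : Set ℝ) (hJ : J = Set.Ioo a b)
    (hind : ∀ t ∈ J, AffineIndependent ℝ (fun i => p i t)) :
    (∀ t ∈ J, HasDerivAt (totalMeanCurvature p)
      ((1 / 2) * (tetraEdges.map (fun e => edgeAngle p e t * deriv (edgeLen p e) t)).sum) t) ∧
    (∀ e0 ∈ tetraEdges, (∀ t ∈ J, edgeLen p e0 t = 2 * t) →
      (∀ e ∈ tetraEdges, e ≠ e0 → ∀ s ∈ J, ∀ s' ∈ J, edgeLen p e s = edgeLen p e s') →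
      ∀ t ∈ J, deriv (totalMeanCurvature p) t = edgeAngle p e0 t) := by
  have hdiff : ∀ i t, DifferentiableAt ℝ (p i) t := fun i t =>
    ((hp i).differentiable (by norm_num)).differentiableAt
  have main : ∀ t ∈ J, HasDerivAt (totalMeanCurvature p)
      ((1 / 2) * (tetraEdges.map (fun e => edgeAngle p e t * deriv (edgeLen p e) t)).sum) t := by
    intro t ht
    obtain ⟨φ, hφ, hsum⟩ := exists_hasDerivAt_edgeAngle (fun i => hdiff i t) (hind t ht)
    have hlen : ∀ e ∈ tetraEdges, HasDerivAt (edgeLen p e) (deriv (edgeLen p e) t) t := by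
      intro e he
      have hne : e.1 ≠ e.2.1 := by
        revert e
        simp [tetraEdges]
      exact (((hdiff e.1 t).sub (hdiff e.2.1 t)).norm ℝ
        (sub_ne_zero.mpr ((hind t ht).injective.ne hne))).hasDerivAt
    have hprod := fun e he => (hlen e he).fun_mul (hφ e he)
    simp only [tetraEdges, List.mem_cons, List.not_mem_nil, or_false, forall_eq_or_imp,
      forall_eq, List.map_cons, List.map_nil, List.sum_cons, List.sum_nil, add_zero]
      at hprod hsum ⊢
    obtain ⟨h₁, h₂, h₃, h₄, h₅, h₆⟩ := hprod
    have hH : totalMeanCurvature p = fun s => (1 / 2) *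
        ((tetraEdges.map fun e => edgeLen p e s * edgeAngle p e s).sum) := rfl
    simp only [tetraEdges, List.map_cons, List.map_nil, List.sum_cons, List.sum_nil,
      add_zero] at hH
    rw [hH]
    refine ((h₁.fun_add (h₂.fun_add (h₃.fun_add (h₄.fun_add
      (h₅.fun_add h₆))))).const_mul (1 / 2)).congr_deriv ?_
    linear_combination (1 / 2) * hsum
  refine ⟨main, fun e0 he0 hlen hconst t ht => ?_⟩
  have hJt : J ∈ nhds t := by
    subst hJ
    exact isOpen_Ioo.mem_nhds ht
  have hd0 : deriv (edgeLen p e0) t = 2 := by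
    have : edgeLen p e0 =ᶠ[nhds t] fun s => 2 * s := Filter.mem_of_superset hJt hlen
    rw [this.deriv_eq]
    simp
  have hd : ∀ e ∈ tetraEdges, edgeAngle p e t * deriv (edgeLen p e) t
      = if e = e0 then 2 * edgeAngle p e0 t else 0 := by
    intro e he
    split_ifs with hee
    · rw [hee, hd0, mul_comm]
    · have : edgeLen p e =ᶠ[nhds t] fun _ => edgeLen p e t :=
        Filter.mem_of_superset hJt fun s hs => hconst e he hee s hs t ht
      rw [this.deriv_eq]
      simp
  rw [(main t ht).deriv, List.map_congr_left hd]
  clear hlen hconst hd0 hd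
  generalize edgeAngle p e0 t = c
  have hcount : (tetraEdges.map fun e => if e = e0 then 2 * c else 0).sum = 2 * c := by
    fin_cases he0 <;> simp [tetraEdges]
  rw [hcount]
  ring
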